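/- For every element f of Thompson's group F there exists a pair (S, T) of binary trees with the same number of leaves that represents f, i.e., f maps the i-th interval of P(S) affinely onto the i-th interval of P(T) for every i. -/

import Mathlib

/-- A real number is dyadic if it has the form `a / 2 ^ b` with `a : ℤ`, `b : ℕ`. -/
def IsDyadic (x : ℝ) : Prop := ∃ (a : ℤ) (b : ℕ), x = (a : ℝ) / 2 ^ b

/-- `f : ℝ → ℝ` is (the extension of) an element of Thompson's group `F`:
a self-homeomorphism of `[0,1]` (continuous bijection of the compact interval onto itself)
fixing the endpoints, which is piecewise affine with dyadic breakpoints and slopes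
integer powers of `2`. -/
def InThompsonF (f : ℝ → ℝ) : Prop :=
  f 0 = 0 ∧ f 1 = 1 ∧
  ContinuousOn f (Set.Icc 0 1) ∧
  Set.BijOn f (Set.Icc 0 1) (Set.Icc 0 1) ∧
  ∃ (n : ℕ) (x : ℕ → ℝ), 0 < n ∧ x 0 = 0 ∧ x n = 1 ∧
    (∀ i < n, x i < x (i + 1)) ∧
    (∀ i ≤ n, IsDyadic (x i)) ∧
    (∀ i < n, ∃ (k : ℤ) (c : ℝ), ∀ t ∈ Set.Icc (x i) (x (i + 1)),
      f t = (2 : ℝ) ^ k * t + c)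


/-- A planar rooted binary tree. -/
inductive BinTree : Type
  | leaf : BinTree
  | node : BinTree → BinTree → BinTree
deriving DecidableEq

/-- The number of leaves of a binary tree. -/
def BinTree.numLeaves : BinTree → ℕ
  | .leaf => 1
  | .node l r => l.numLeaves + r.numLeaves

/-- The list of intervals (recorded as pairs of endpoints) that a binary tree associates to the
interval `[a, b]`: a leaf yields `[a,b]` itself, and a node splits `[a,b]` at its midpoint. -/
noncomputable def treePartition : BinTree → ℝ → ℝ → List (ℝ × ℝ)
  | .leaf, a, b => [(a, b)]
  | .node l r, a, b => treePartition l a ((a + b) / 2) ++ treePartition r ((a + b) / 2) b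

/-- A pair `(S, T)` of binary trees with the same number of leaves represents `f` if `f` maps
the `i`-th interval of the partition `P(S)` affinely onto the `i`-th interval of `P(T)`,
for every `i`. -/
def Represents (S T : BinTree) (f : ℝ → ℝ) : Prop :=
  S.numLeaves = T.numLeaves ∧
  ∀ i < S.numLeaves,
    (∃ k c : ℝ,
      ∀ t ∈ Set.Icc ((treePartition S 0 1)[i]!).1 ((treePartition S 0 1)[i]!).2,
        f t = k * t + c) ∧
    f '' Set.Icc ((treePartition S 0 1)[i]!).1 ((treePartition S 0 1)[i]!).2 =
      Set.Icc ((treePartition T 0 1)[i]!).1 ((treePartition T 0 1)[i]!).2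

/-- A standard dyadic interval `[k / 2^n, (k+1) / 2^n]`. -/
def StdI (a b : ℝ) : Prop := ∃ (k : ℤ) (n : ℕ), a = (k : ℝ) / 2 ^ n ∧ b = ((k : ℝ) + 1) / 2 ^ n

theorem StdI.lt {a b : ℝ} (h : StdI a b) : a < b := by
  obtain ⟨k, n, rfl, rfl⟩ := h
  have : (0 : ℝ) < 2 ^ n := by positivity
  exact div_lt_div_of_pos_right (by linarith) this

theorem StdI.left {a b : ℝ} (h : StdI a b) : StdI a ((a + b) / 2) := by
  obtain ⟨k, n, rfl, rfl⟩ := h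
  refine ⟨2 * k, n + 1, ?_, ?_⟩ <;> push_cast <;> rw [pow_succ] <;> field_simp <;> ring

theorem StdI.right {a b : ℝ} (h : StdI a b) : StdI ((a + b) / 2) b := by
  obtain ⟨k, n, rfl, rfl⟩ := h
  refine ⟨2 * k + 1, n + 1, ?_, ?_⟩ <;> push_cast <;> rw [pow_succ] <;> field_simp <;> ring

/-- A standard interval inside another one and containing its midpoint in the interior is
the whole interval. -/
theorem StdI.eq_of_mid {a b u v : ℝ} (h : StdI a b) (h' : StdI u v) (hau : a ≤ u) (hvb : v ≤ b)
    (h1 : u < (a + b) / 2) (h2 : (a + b) / 2 < v) : u = a ∧ v = b := by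
  obtain ⟨k, r, rfl, rfl⟩ := h
  obtain ⟨j, s, rfl, rfl⟩ := h'
  rcases le_or_gt s r with hsr | hsr
  · have hle : (1 : ℝ) / 2 ^ r ≤ 1 / 2 ^ s :=
      one_div_le_one_div_of_le (by positivity) (pow_le_pow_right₀ (by norm_num) hsr)
    rw [add_div] at hvb h2 ⊢
    rw [add_div (k : ℝ)] at hvb ⊢
    constructor <;> linarith
  · exfalso
    obtain ⟨d, rfl⟩ := Nat.exists_eq_add_of_lt hsr
    have hm : ((k : ℝ) / 2 ^ r + ((k : ℝ) + 1) / 2 ^ r) / 2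
        = (((2 * k + 1) * 2 ^ d : ℤ) : ℝ) / 2 ^ (r + d + 1) := by
      push_cast
      rw [pow_succ, pow_add]
      field_simp
      ring
    rw [hm] at h1 h2
    have hp : (0 : ℝ) < 2 ^ (r + d + 1) := by positivity
    rw [div_lt_div_iff_of_pos_right hp] at h1 h2
    have h1' : j < (2 * k + 1) * 2 ^ d := by exact_mod_cast h1
    have h2' : (2 * k + 1) * 2 ^ d < j + 1 := by exact_mod_cast h2
    omega

theorem y_mono (y : ℕ → ℝ) (p n : ℕ) (hs : ∀ i, p ≤ i → i < p + n → StdI (y i) (y (i + 1)))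
    (i d : ℕ) (hi : p ≤ i) (hd : i + d ≤ p + n) : y i ≤ y (i + d) := by
  induction d with
  | zero => simp
  | succ d ih =>
    have := (hs (i + d) (by omega) (by omega)).lt
    have := ih (by omega)
    rw [← add_assoc]
    linarith

theorem exists_split (y : ℕ → ℝ) (p n : ℕ) (hn : 2 ≤ n)
    (hs : ∀ i, p ≤ i → i < p + n → StdI (y i) (y (i + 1))) (h : StdI (y p) (y (p + n))) :
    ∃ k, 0 < k ∧ k < n ∧ y (p + k) = (y p + y (p + n)) / 2 := by
  classical
  have hlt := h.lt
  have hex : ∃ k, (y p + y (p + n)) / 2 ≤ y (p + k) := ⟨n, by linarith⟩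
  set k := Nat.find hex with hk
  have hk1 : (y p + y (p + n)) / 2 ≤ y (p + k) := Nat.find_spec hex
  have hkn : k ≤ n := Nat.find_min' hex (by linarith)
  have hk0 : k ≠ 0 := by
    intro h0
    rw [h0] at hk1
    simp only [add_zero] at hk1
    linarith
  obtain ⟨l, hl⟩ := Nat.exists_eq_succ_of_ne_zero hk0
  have hl1 : y (p + l) < (y p + y (p + n)) / 2 := by
    have := Nat.find_min hex (m := l) (by omega)
    exact not_le.mp this
  rw [hl] at hk1 hkn
  have hkl : p + l.succ = p + l + 1 := rfl
  rcases hk1.eq_or_lt with he | hlt'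
  · refine ⟨l + 1, by omega, ?_, he.symm⟩
    rcases hkn.eq_or_lt with h' | h'
    · rw [h'] at he
      linarith
    · exact h'
  · exfalso
    have hA := y_mono y p n hs p l le_rfl (by omega)
    have hB := y_mono y p n hs (p + l + 1) (n - (l + 1)) (by omega) (by omega)
    rw [show p + l + 1 + (n - (l + 1)) = p + n by omega] at hB
    obtain ⟨e1, e2⟩ := h.eq_of_mid (hs (p + l) (by omega) (by omega)) hA hB hl1 hlt'
    rcases Nat.eq_zero_or_pos l with h0 | h0
    · subst h0
      have h3 := (hs (p + 1) (by omega) (by omega)).lt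
      have h4 := y_mono y p n hs (p + 1 + 1) (n - 2) (by omega) (by omega)
      rw [show p + 1 + 1 + (n - 2) = p + n by omega] at h4
      simp only [add_zero] at e2
      linarith
    · have h3 := (hs p (by omega) (by omega)).lt
      have h4 := y_mono y p n hs (p + 1) (l - 1) (by omega) (by omega)
      rw [show p + 1 + (l - 1) = p + l by omega] at h4
      linarith

theorem treePartition_length (T : BinTree) (a b : ℝ) :
    (treePartition T a b).length = T.numLeaves := by
  induction T generalizing a b with
  | leaf => rfl
  | node l r ihl ihr => simp [treePartition, BinTree.numLeaves, ihl, ihr]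

theorem exists_tree (n : ℕ) : ∀ (y : ℕ → ℝ) (p : ℕ), 0 < n →
    (∀ i, p ≤ i → i < p + n → StdI (y i) (y (i + 1))) → StdI (y p) (y (p + n)) →
    ∃ T : BinTree, treePartition T (y p) (y (p + n)) =
      (List.range' p n).map (fun i => (y i, y (i + 1))) := by
  induction n using Nat.strong_induction_on with
  | _ n ih =>
    intro y p hn hs h
    rcases Nat.lt_or_ge 1 n with h1 | h1
    · obtain ⟨k, hk0, hkn, hk⟩ := exists_split y p n h1 hs h
      obtain ⟨L, hL⟩ := ih k hkn y p hk0 (fun i a b => hs i a (by omega)) (by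
        rw [hk]; exact h.left)
      have e : p + k + (n - k) = p + n := by omega
      obtain ⟨R, hR⟩ := ih (n - k) (by omega) y (p + k) (by omega)
        (fun i a b => hs i (by omega) (by omega)) (by
        rw [e, hk]; exact h.right)
      refine ⟨.node L R, ?_⟩
      rw [treePartition, ← hk, hL]
      rw [e] at hR
      rw [hR, ← List.map_append, List.range'_append_1, Nat.add_sub_cancel' hkn.le]
    · obtain rfl : n = 1 := by omega
      exact ⟨.leaf, by simp [treePartition]⟩

theorem IsDyadic.add {x y : ℝ} (hx : IsDyadic x) (hy : IsDyadic y) : IsDyadic (x + y) := by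
  obtain ⟨a, b, rfl⟩ := hx
  obtain ⟨c, d, rfl⟩ := hy
  refine ⟨a * 2 ^ d + c * 2 ^ b, b + d, ?_⟩
  push_cast
  rw [pow_add]
  field_simp

theorem IsDyadic.neg {x : ℝ} (hx : IsDyadic x) : IsDyadic (-x) := by
  obtain ⟨a, b, rfl⟩ := hx
  exact ⟨-a, b, by push_cast; ring⟩

theorem IsDyadic.zpow_mul {x : ℝ} (hx : IsDyadic x) (k : ℤ) : IsDyadic ((2 : ℝ) ^ k * x) := by
  obtain ⟨a, b, rfl⟩ := hx
  obtain ⟨m, rfl | rfl⟩ := k.eq_nat_or_neg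
  · refine ⟨a * 2 ^ m, b, ?_⟩
    push_cast
    rw [zpow_natCast]
    ring
  · refine ⟨a, b + m, ?_⟩
    rw [zpow_neg, zpow_natCast, pow_add]
    field_simp

theorem IsDyadic.eventually {x : ℝ} (hx : IsDyadic x) :
    ∃ M : ℕ, ∀ N, M ≤ N → ∃ a : ℤ, x = (a : ℝ) / 2 ^ N := by
  obtain ⟨a, b, rfl⟩ := hx
  refine ⟨b, fun N hN => ?_⟩
  obtain ⟨d, rfl⟩ := Nat.exists_eq_add_of_le hN
  refine ⟨a * 2 ^ d, ?_⟩
  push_cast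
  rw [pow_add]
  field_simp

theorem piece {f : ℝ → ℝ} {u v c : ℝ} {k : ℤ} (hv : IsDyadic v) (hc : IsDyadic c)
    (hf : ∀ t ∈ Set.Icc u v, f t = (2 : ℝ) ^ k * t + c) :
    ∃ M : ℕ, ∀ N, M ≤ N → ∀ j : ℤ, u ≤ (j : ℝ) / 2 ^ N → (j : ℝ) / 2 ^ N < v →
      (∃ k c : ℝ, ∀ t ∈ Set.Icc ((j : ℝ) / 2 ^ N) (((j : ℝ) + 1) / 2 ^ N), f t = k * t + c) ∧
      f '' Set.Icc ((j : ℝ) / 2 ^ N) (((j : ℝ) + 1) / 2 ^ N)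
        = Set.Icc (f ((j : ℝ) / 2 ^ N)) (f (((j : ℝ) + 1) / 2 ^ N)) ∧
      StdI (f ((j : ℝ) / 2 ^ N)) (f (((j : ℝ) + 1) / 2 ^ N)) := by
  obtain ⟨M1, h1⟩ := hv.eventually
  obtain ⟨M2, h2⟩ := hc.eventually
  refine ⟨M1 + M2 + k.natAbs, fun N hN j huj hjv => ?_⟩
  obtain ⟨a, ha⟩ := h1 N (by omega)
  have hp : (0 : ℝ) < 2 ^ N := by positivity
  have hj1 : ((j : ℝ) + 1) / 2 ^ N ≤ v := by
    rw [ha] at hjv ⊢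
    rw [div_lt_div_iff_of_pos_right hp] at hjv
    rw [div_le_div_iff_of_pos_right hp]
    have : j < a := by exact_mod_cast hjv
    exact_mod_cast this
  have hjj : (j : ℝ) / 2 ^ N ≤ ((j : ℝ) + 1) / 2 ^ N := by
    rw [div_le_div_iff_of_pos_right hp]; linarith
  have hf' : ∀ t ∈ Set.Icc ((j : ℝ) / 2 ^ N) (((j : ℝ) + 1) / 2 ^ N),
      f t = (2 : ℝ) ^ k * t + c := fun t ht => hf t ⟨huj.trans ht.1, ht.2.trans hj1⟩
  have hk : (0 : ℝ) < (2 : ℝ) ^ k := by positivity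
  refine ⟨⟨_, _, hf'⟩, ?_, ?_⟩
  · rw [Set.image_congr hf', Set.image_affine_Icc' hk, hf' _ ⟨le_rfl, hjj⟩, hf' _ ⟨hjj, le_rfl⟩]
  · rw [hf' _ ⟨le_rfl, hjj⟩, hf' _ ⟨hjj, le_rfl⟩]
    obtain ⟨s, hs⟩ : ∃ s : ℕ, (s : ℤ) = N - k := ⟨(N - k).toNat, by omega⟩
    obtain ⟨e, he⟩ := h2 s (by omega)
    have hks : (2 : ℝ) ^ k = 2 ^ N / 2 ^ s := by
      have : k = (N : ℤ) - (s : ℤ) := by omega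
      rw [this, zpow_sub₀ (by norm_num), zpow_natCast, zpow_natCast]
    refine ⟨j + e, s, ?_, ?_⟩ <;> rw [hks, he] <;> push_cast <;> field_simp
    ring

theorem exists_piece (x : ℕ → ℝ) (n : ℕ) (t : ℝ) (h0 : x 0 ≤ t) (hn : t < x n) :
    ∃ i < n, x i ≤ t ∧ t < x (i + 1) := by
  induction n with
  | zero => linarith
  | succ n ih =>
    rcases lt_or_ge t (x n) with h | h
    · obtain ⟨i, hi, h'⟩ := ih h
      exact ⟨i, by omega, h'⟩
    · exact ⟨n, by omega, h, hn⟩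

/-- Every element of Thompson's group `F` is represented by a pair of binary trees with the
same number of leaves. -/
theorem thompsonF_exists_tree_pair (f : ℝ → ℝ) (hf : InThompsonF f) :
    ∃ S T : BinTree, Represents S T f := by
  obtain ⟨f0, f1, -, -, n, x, hn, x0, xn, hlt, hdy, haff⟩ := hf
  have hfd : ∀ i ≤ n, IsDyadic (f (x i)) := by
    intro i
    induction i with
    | zero => intro _; rw [x0, f0]; exact ⟨0, 0, by simp⟩
    | succ i ih =>
      intro hi
      obtain ⟨k, c, hkc⟩ := haff i (by omega)
      have hl := hlt i (by omega)
      have e1 := hkc (x i) ⟨le_rfl, hl.le⟩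
      have e2 := hkc (x (i + 1)) ⟨hl.le, le_rfl⟩
      have : f (x (i + 1)) = f (x i) + (2 : ℝ) ^ k * (x (i + 1) + -x i) := by
        rw [e1, e2]; ring
      rw [this]
      exact (ih (by omega)).add (((hdy _ hi).add (hdy i (by omega)).neg).zpow_mul k)
  have hpc : ∀ i, ∃ M : ℕ, i < n → ∀ N, M ≤ N → ∀ j : ℤ, x i ≤ (j : ℝ) / 2 ^ N →
      (j : ℝ) / 2 ^ N < x (i + 1) →
      (∃ k c : ℝ, ∀ t ∈ Set.Icc ((j : ℝ) / 2 ^ N) (((j : ℝ) + 1) / 2 ^ N), f t = k * t + c) ∧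
      f '' Set.Icc ((j : ℝ) / 2 ^ N) (((j : ℝ) + 1) / 2 ^ N)
        = Set.Icc (f ((j : ℝ) / 2 ^ N)) (f (((j : ℝ) + 1) / 2 ^ N)) ∧
      StdI (f ((j : ℝ) / 2 ^ N)) (f (((j : ℝ) + 1) / 2 ^ N)) := by
    intro i
    by_cases hi : i < n
    · obtain ⟨k, c, hkc⟩ := haff i hi
      have hl := hlt i hi
      have e1 := hkc (x i) ⟨le_rfl, hl.le⟩
      have hc : IsDyadic c := by
        have : c = f (x i) + -((2 : ℝ) ^ k * x i) := by rw [e1]; ring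
        rw [this]
        exact (hfd i hi.le).add ((hdy i hi.le).zpow_mul k).neg
      obtain ⟨M, hM⟩ := piece (hdy (i + 1) hi) hc hkc
      exact ⟨M, fun _ => hM⟩
    · exact ⟨0, fun h => absurd h hi⟩
  choose M hM using hpc
  set N := ∑ i ∈ Finset.range n, M i with hN
  have hp : (0 : ℝ) < 2 ^ N := by positivity
  set z : ℕ → ℝ := fun j => (j : ℝ) / 2 ^ N with hz
  have hzs : ∀ j, z (j + 1) = ((j : ℝ) + 1) / 2 ^ N := fun j => by simp [hz]
  have key : ∀ j : ℕ, j < 2 ^ N →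
      (∃ k c : ℝ, ∀ t ∈ Set.Icc (z j) (z (j + 1)), f t = k * t + c) ∧
      f '' Set.Icc (z j) (z (j + 1)) = Set.Icc (f (z j)) (f (z (j + 1))) ∧
      StdI (f (z j)) (f (z (j + 1))) := by
    intro j hj
    have hj1 : z j < 1 := by
      rw [hz]
      simp only
      rw [div_lt_one hp]
      exact_mod_cast hj
    obtain ⟨i, hi, ha, hb⟩ := exists_piece x n (z j) (by rw [x0]; positivity) (by rw [xn]; exact hj1)
    have hMN : M i ≤ N :=
      Finset.single_le_sum (f := M) (fun _ _ => Nat.zero_le _) (Finset.mem_range.mpr hi)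
    have := hM i hi N hMN j (by simpa [hz] using ha) (by simpa [hz] using hb)
    rw [hzs]
    simpa [hz] using this
  have z0 : z 0 = 0 := by simp [hz]
  have z1 : z (0 + 2 ^ N) = 1 := by simp [hz]
  have h01 : StdI 0 1 := ⟨0, 0, by simp, by simp⟩
  obtain ⟨S, hS⟩ := exists_tree (2 ^ N) z 0 (by positivity)
    (fun i _ _ => ⟨i, N, by simp [hz], by simp [hz]⟩) (by rw [z0, z1]; exact h01)
  obtain ⟨T, hT⟩ := exists_tree (2 ^ N) (fun j => f (z j)) 0 (by positivity)
    (fun i _ hi => (key i (by omega)).2.2) (by simp only [z0, z1, f0, f1]; exact h01)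
  simp only [z0, z1, f0, f1] at hS hT
  have lS : S.numLeaves = 2 ^ N := by rw [← treePartition_length S 0 1, hS]; simp
  have lT : T.numLeaves = 2 ^ N := by rw [← treePartition_length T 0 1, hT]; simp
  refine ⟨S, T, by rw [lS, lT], fun i hi => ?_⟩
  rw [lS] at hi
  have eS : (treePartition S 0 1)[i]! = (z i, z (i + 1)) := by
    rw [hS, getElem!_pos _ _ (by simpa using hi)]; simp
  have eT : (treePartition T 0 1)[i]! = (f (z i), f (z (i + 1))) := by
    rw [hT, getElem!_pos _ _ (by simpa using hi)]; simp
  rw [eS, eT]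
  exact ⟨(key i hi).1, (key i hi).2.1⟩
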